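/- arXiv:2010.10494 — 2 statements merged into one kernel-verified Lean document; each statement's English description precedes it below -/
import Mathlib

section
/- For every odd integer m ≥ 9 the (m,4) secure decentralized pliable index coding problem with circular side information is not linearly feasible: for every length ℓ and every decentralized linear code G of length ℓ for parameters (m, s = 4), G is not simultaneously correct and secure. -/
namespace SDPicod

/-- Side information set of user `i`: the `s` cyclically consecutive message
indices ending at `i`, i.e. `{i - k : k ∈ Finset.range s}`. -/
def sideInfo (m s : ℕ) (i : ZMod m) : Set (ZMod m) :=
  {j | ∃ k ∈ Finset.range s, j = i - (k : ZMod m)}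

/-- A decentralized linear code: every row is encodable by some user, i.e.
its support is contained in that user's side information set. -/
def IsDecentralizedCode (m s : ℕ) {ℓ : ℕ} (G : Fin ℓ → ZMod m → ZMod 2) : Prop :=
  ∀ t : Fin ℓ, ∃ i : ZMod m, Function.support (G t) ⊆ sideInfo m s i

/-- The set of message indices user `i` can decode: indices `j` outside the
side information set such that the standard basis vector `e j` lies in the
`GF(2)`-span of the rows of `G` together with the basis vectors of the
side information set. -/
def decSet (m s : ℕ) {ℓ : ℕ} (G : Fin ℓ → ZMod m → ZMod 2) (i : ZMod m) :
    Set (ZMod m) :=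
  {j | j ∉ sideInfo m s i ∧
    Pi.single j (1 : ZMod 2) ∈ Submodule.span (ZMod 2)
      (Set.range G ∪ {v | ∃ k ∈ sideInfo m s i, v = Pi.single k (1 : ZMod 2)})}

/-- Correctness: every user can decode at least one new message. -/
def Correct (m s : ℕ) {ℓ : ℕ} (G : Fin ℓ → ZMod m → ZMod 2) : Prop :=
  ∀ i : ZMod m, (decSet m s G i).Nonempty

/-- Security: no user can decode more than one new message. -/
def Secure (m s : ℕ) {ℓ : ℕ} (G : Fin ℓ → ZMod m → ZMod 2) : Prop :=
  ∀ i : ZMod m, (decSet m s G i).Subsingleton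

end SDPicod

open SDPicod

theorem single_notMem_span_of_distinct_ends {ι K : Type*} [DecidableEq ι] [Field K]
    (pos : ι → ℕ) (F : Set (ι → K)) (lo hi : (ι → K) → ι)
    (hlo : ∀ f ∈ F, f (lo f) ≠ 0) (hhi : ∀ f ∈ F, f (hi f) ≠ 0)
    (hlt : ∀ f ∈ F, pos (lo f) < pos (hi f))
    (hsupp : ∀ f ∈ F, ∀ y, f y ≠ 0 → pos (lo f) ≤ pos y ∧ pos y ≤ pos (hi f))
    (hlo_inj : ∀ f ∈ F, ∀ g ∈ F, pos (lo f) = pos (lo g) → f = g)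
    (hhi_inj : ∀ f ∈ F, ∀ g ∈ F, pos (hi f) = pos (hi g) → f = g) (x : ι) :
    (Pi.single x 1 : ι → K) ∉ Submodule.span K F := by
  classical
  intro hx
  obtain ⟨c, t, htF, hct, hsum⟩ := Submodule.mem_span_iff_exists_finset_subset.1 hx
  set u := t.filter (fun f => c f ≠ 0) with hu
  have hsum' : ∑ f ∈ u, c f • f = (Pi.single x 1 : ι → K) := by
    rw [← hsum, hu]
    refine Finset.sum_filter_of_ne fun f _ hf h0 => hf ?_
    rw [h0, zero_smul]
  have huF : ∀ f ∈ u, f ∈ F := fun f hf => htF (Finset.mem_filter.1 hf).1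
  have huc : ∀ f ∈ u, c f ≠ 0 := fun f hf => (Finset.mem_filter.1 hf).2
  have hune : u.Nonempty := by
    by_contra h
    rw [Finset.not_nonempty_iff_eq_empty.1 h, Finset.sum_empty] at hsum'
    simpa using congrFun hsum' x
  have eval_eq : ∀ f ∈ u, ∀ y, f y ≠ 0 → (∀ g ∈ u, g y ≠ 0 → g = f) → y = x := by
    intro f hf y hfy huniq
    by_contra hyx
    have h1 := congrFun hsum' y
    rw [Pi.single_eq_of_ne hyx, Finset.sum_apply, Finset.sum_eq_single f] at h1
    · exact mul_ne_zero (huc f hf) hfy h1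
    · intro g hg hgf
      by_contra h
      exact hgf (huniq g hg fun h0 => h (by simp [h0]))
    · exact fun h => absurd hf h
  obtain ⟨f, hf, hfmin⟩ := u.exists_min_image (fun f => pos (lo f)) hune
  obtain ⟨g, hg, hgmax⟩ := u.exists_max_image (fun f => pos (hi f)) hune
  have h1 : lo f = x := eval_eq f hf _ (hlo f (huF f hf)) fun b hb hby =>
    hlo_inj b (huF b hb) f (huF f hf)
      (le_antisymm (hsupp b (huF b hb) _ hby).1 (hfmin b hb))
  have h2 : hi g = x := eval_eq g hg _ (hhi g (huF g hg)) fun b hb hby =>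
    hhi_inj b (huF b hb) g (huF g hg)
      (le_antisymm (hgmax b hb) (hsupp b (huF b hb) _ hby).2)
  have h3 := hlt g (huF g hg)
  have h4 := hfmin g hg
  rw [h2, ← h1] at h3
  exact absurd h3 (not_lt.2 h4)

namespace SDPicod

variable {m : ℕ}

/-- The four cyclically consecutive indices starting at `a`. -/
def arc (a : ZMod m) : Set (ZMod m) := {y | ∃ k : ℕ, k < 4 ∧ y = a + k}

/-- The holder of `arc a` recovers `j` from the code `W`. -/
def Decodes (W : Submodule (ZMod 2) (ZMod m → ZMod 2)) (a j : ZMod m) : Prop :=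
  j ∉ arc a ∧ ∃ w ∈ W, w j ≠ 0 ∧ ∀ y ∉ arc a, y ≠ j → w y = 0

/-- `w` is a codeword supported in `{s, …, s + d}` and nonzero at both ends. -/
def Spans (W : Submodule (ZMod 2) (ZMod m → ZMod 2)) (s : ZMod m) (d : ℕ)
    (w : ZMod m → ZMod 2) : Prop :=
  w ∈ W ∧ w s ≠ 0 ∧ w (s + d) ≠ 0 ∧ ∀ y, w y ≠ 0 → ∃ k ≤ d, y = s + k

theorem natCast_inj_of_lt {n k : ℕ} (hn : n < m) (hk : k < m)
    (h : (n : ZMod m) = k) : n = k := by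
  rw [ZMod.natCast_eq_natCast_iff, Nat.ModEq, Nat.mod_eq_of_lt hn, Nat.mod_eq_of_lt hk] at h
  exact h

theorem natCast_ne_zero_of_lt {n : ℕ} (h0 : 0 < n) (hn : n < m) : (n : ZMod m) ≠ 0 := by
  intro h
  have := natCast_inj_of_lt hn (h0.trans hn) (by simpa using h)
  omega

theorem notMem_arc {a y : ZMod m} (n : ℕ) (h4 : 4 ≤ n) (hn : n < m) (hy : y = a + n) :
    y ∉ arc a := by
  rintro ⟨k, hk, rfl⟩
  have := natCast_inj_of_lt (hk.trans (h4.trans_lt hn)) hn (add_left_cancel hy)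
  omega

theorem self_notMem_arc_succ (hm : 9 ≤ m) (a : ZMod m) : a ∉ arc (a + 1) := by
  refine notMem_arc (m - 1) (by omega) (by omega) ?_
  rw [Nat.cast_sub (by omega)]
  simp

theorem mem_arc_succ {a y : ZMod m} (h : y ∈ arc (a + 1)) (h4 : y ≠ a + 4) : y ∈ arc a := by
  obtain ⟨k, hk, rfl⟩ := h
  refine ⟨k + 1, ?_, by push_cast; ring⟩
  by_contra h
  obtain rfl : k = 3 := by omega
  exact h4 (by push_cast; ring)

theorem mem_arc_of_succ {a y : ZMod m} (h : y ∈ arc a) (ha : y ≠ a) : y ∈ arc (a + 1) := by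
  obtain ⟨k, hk, rfl⟩ := h
  rcases k with _ | k
  · simp at ha
  · exact ⟨k, by omega, by push_cast; ring⟩

theorem zmod_two_eq_one {x : ZMod 2} (h : x ≠ 0) : x = 1 := by
  revert x
  decide

section

variable {W : Submodule (ZMod 2) (ZMod m → ZMod 2)}

theorem Decodes.trans {a b j y : ZMod m} (hj : Decodes W a j) (hy : Decodes W b y)
    (hb : ∀ z ∈ arc b, z ∈ arc a ∨ z = j) (hya : y ∉ arc a) (hyj : y ≠ j) :
    Decodes W a y := by
  obtain ⟨hja, w, hw, hwj, hw0⟩ := hj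
  obtain ⟨hyb, v, hv, hvy, hv0⟩ := hy
  refine ⟨hya, v - v j • w, W.sub_mem hv (W.smul_mem _ hw), ?_, ?_⟩
  · simpa [hw0 y hya hyj] using hvy
  · intro z hza hzy
    by_cases hzj : z = j
    · subst hzj
      simp [zmod_two_eq_one hwj]
    · have hzb : z ∉ arc b := fun h => (hb z h).elim hza hzj
      simp [hw0 z hza hzj, hv0 z hzb hzy]

theorem decodes_succ_iff (hC : ∀ a, ∃ j, Decodes W a j)
    (hS : ∀ a j k, Decodes W a j → Decodes W a k → j = k) (a : ZMod m) :
    Decodes W a (a + 4) ↔ Decodes W (a + 1) a := by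
  constructor
  · intro h
    obtain ⟨y, hy⟩ := hC (a + 1)
    by_cases hya : y = a
    · rwa [hya] at hy
    have hyn : y ∉ arc a := fun hya' => hy.1 (mem_arc_of_succ hya' hya)
    have hy4 : y ≠ a + 4 := fun h4 => hy.1 ⟨3, by omega, by rw [h4]; push_cast; ring⟩
    refine absurd (hS _ _ _ (h.trans hy (fun z hz => ?_) hyn hy4) h) hy4
    exact or_iff_not_imp_right.2 fun h4 => mem_arc_succ hz h4
  · intro h
    obtain ⟨y, hy⟩ := hC a
    by_cases hy4 : y = a + 4
    · rwa [hy4] at hy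
    have hyn : y ∉ arc (a + 1) := fun h' => hy.1 (mem_arc_succ h' hy4)
    have hya : y ≠ a := fun h' => hy.1 ⟨0, by omega, by simp [h']⟩
    refine absurd (hS _ _ _ (h.trans hy (fun z hz => ?_) hyn hya) h) hya
    exact or_iff_not_imp_right.2 fun h4 => mem_arc_of_succ hz h4

theorem not_decodes_consecutive (hm : 9 ≤ m) (hC : ∀ a, ∃ j, Decodes W a j)
    (hS : ∀ a j k, Decodes W a j → Decodes W a k → j = k) {a b : ZMod m}
    (hab : b = a + 1) (ha : Decodes W a (a + 4)) (hb : Decodes W b (b + 4)) : False := by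
  subst hab
  have h := hS _ _ _ hb ((decodes_succ_iff hC hS a).1 ha)
  refine natCast_ne_zero_of_lt (m := m) (n := 5) (by omega) (by omega) ?_
  push_cast
  linear_combination h

theorem Spans.decodes_right (hm : 9 ≤ m) {s : ZMod m} {d : ℕ} {w : ZMod m → ZMod 2}
    (hw : Spans W s d w) (hd : d ≤ 3) {b : ZMod m} (hb : s + d = b + 4) :
    Decodes W b (b + 4) := by
  obtain ⟨hwW, -, hwe, hsupp⟩ := hw
  refine ⟨notMem_arc 4 le_rfl (by omega) (by push_cast; ring), w, hwW, hb ▸ hwe, ?_⟩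
  intro y hy hyb
  by_contra h0
  obtain ⟨k, hk, rfl⟩ := hsupp y h0
  have hkd : k ≠ d := by rintro rfl; exact hyb hb
  refine hy ⟨k + 4 - d, by omega, ?_⟩
  rw [Nat.cast_sub (by omega)]
  push_cast
  linear_combination hb

theorem Spans.decodes_left (hm : 9 ≤ m) {s : ZMod m} {d : ℕ} {w : ZMod m → ZMod 2}
    (hw : Spans W s d w) (hd : d ≤ 3) : Decodes W (s + 1) s := by
  obtain ⟨hwW, hws, -, hsupp⟩ := hw
  refine ⟨self_notMem_arc_succ hm s, w, hwW, hws, ?_⟩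
  intro y hy hys
  by_contra h0
  obtain ⟨k, hk, rfl⟩ := hsupp y h0
  rcases k with _ | k
  · simp at hys
  · exact hy ⟨k, by omega, by push_cast; ring⟩

theorem exists_spans {p : ZMod m} {g : ZMod m → ZMod 2} (hg : g ∈ W)
    (hp : ∀ y, g y ≠ 0 → y ∈ arc p) (h0 : g ≠ 0) : ∃ s, ∃ d ≤ 3, Spans W s d g := by
  classical
  set T := (Finset.range 4).filter (fun k : ℕ => g (p + k) ≠ 0) with hT
  have hmem : ∀ k, k ∈ T ↔ k < 4 ∧ g (p + k) ≠ 0 := by simp [hT]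
  have hne : T.Nonempty := by
    obtain ⟨y, hy⟩ := Function.ne_iff.1 h0
    obtain ⟨k, hk, rfl⟩ := hp y hy
    exact ⟨k, (hmem k).2 ⟨hk, hy⟩⟩
  have hmin := (hmem _).1 (T.min'_mem hne)
  have hmax := (hmem _).1 (T.max'_mem hne)
  have hle : T.min' hne ≤ T.max' hne := T.min'_le _ (T.max'_mem hne)
  have hcast : ∀ k, T.min' hne ≤ k →
      p + (k : ZMod m) = p + (T.min' hne : ℕ) + ((k - T.min' hne : ℕ) : ZMod m) := by
    intro k hk
    rw [Nat.cast_sub hk]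
    ring
  refine ⟨p + (T.min' hne : ℕ), T.max' hne - T.min' hne, by omega, hg, hmin.2, ?_, ?_⟩
  · rw [← hcast _ hle]
    exact hmax.2
  · intro y hy
    obtain ⟨k, hk, rfl⟩ := hp y hy
    have hkT : k ∈ T := (hmem k).2 ⟨hk, hy⟩
    have h1 := T.min'_le _ hkT
    have h2 := T.le_max' _ hkT
    exact ⟨k - T.min' hne, by omega, hcast k h1⟩

theorem exists_ne_zero_of_mem_span {G : Set (ZMod m → ZMod 2)} {w : ZMod m → ZMod 2}
    (hw : w ∈ Submodule.span (ZMod 2) G) {y : ZMod m} (hy : w y ≠ 0) : ∃ g ∈ G, g y ≠ 0 := by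
  by_contra! h
  have hle : Submodule.span (ZMod 2) G ≤
      LinearMap.ker (LinearMap.proj (R := ZMod 2) (φ := fun _ : ZMod m => ZMod 2) y) :=
    Submodule.span_le.2 fun g hg => by simpa using h g hg
  exact hy (by simpa using hle hw)

end

variable {G : Set (ZMod m → ZMod 2)}

theorem single_notMem_code (hm : 9 ≤ m)
    (hC : ∀ a, ∃ j, Decodes (Submodule.span (ZMod 2) G) a j)
    (hS : ∀ a j k, Decodes (Submodule.span (ZMod 2) G) a j →
      Decodes (Submodule.span (ZMod 2) G) a k → j = k)
    (hG : ∀ g ∈ G, ∃ p, ∀ y, g y ≠ 0 → y ∈ arc p) (j : ZMod m)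
    {w : ZMod m → ZMod 2} (hw : w ∈ Submodule.span (ZMod 2) G) (hwj : w j ≠ 0) :
    ∃ y ≠ j, w y ≠ 0 := by
  by_contra! hw0
  have hdec : ∀ b y, Decodes (Submodule.span (ZMod 2) G) b y → j ∉ arc b → y = j :=
    fun b y hy hj => hS b _ _ hy ⟨hj, w, hw, hwj, fun z _ hz => hw0 z hz⟩
  have h4 : Decodes (Submodule.span (ZMod 2) G) (j - 4) (j - 4 + 4) := by
    refine ⟨notMem_arc 4 le_rfl (by omega) (by push_cast; ring), w, hw, ?_, ?_⟩
    · simpa using hwj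
    · intro y _ hy
      exact hw0 y (by simpa using hy)
  obtain ⟨-, v, hv, hvj, -⟩ := (decodes_succ_iff hC hS (j - 4)).1 h4
  obtain ⟨g, hgG, hgj⟩ := exists_ne_zero_of_mem_span hv hvj
  obtain ⟨p, hp⟩ := hG g hgG
  obtain ⟨s, d, hd, hsp⟩ := exists_spans (Submodule.subset_span hgG) hp
    (fun h => hgj (by simp [h]))
  obtain ⟨l, hl, hjl⟩ := hsp.2.2.2 _ hgj
  rcases Nat.eq_zero_or_pos l with rfl | hl0
  · have hdr := hsp.decodes_right hm hd (b := s + d - 4) (by ring)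
    have hj := hdec _ _ hdr (notMem_arc (8 - d) (by omega) (by omega) (by
      rw [Nat.cast_sub (by omega)]
      push_cast at hjl ⊢
      linear_combination hjl))
    refine natCast_ne_zero_of_lt (m := m) (n := 4 - d) (by omega) (by omega) ?_
    rw [Nat.cast_sub (by omega)]
    push_cast at hjl ⊢
    linear_combination -hjl - hj
  · have hdl := hsp.decodes_left hm hd
    have hj := hdec _ _ hdl (notMem_arc (l + 3) (by omega) (by omega) (by
      push_cast
      linear_combination hjl))
    refine natCast_ne_zero_of_lt (m := m) (n := l + 4) (by omega) (by omega) ?_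
    push_cast
    linear_combination -hjl - hj

section

variable {W : Submodule (ZMod 2) (ZMod m → ZMod 2)}

theorem Spans.length (hm : 9 ≤ m) (hC : ∀ a, ∃ j, Decodes W a j)
    (hS : ∀ a j k, Decodes W a j → Decodes W a k → j = k)
    (h1 : ∀ j, ∀ w ∈ W, w j ≠ 0 → ∃ y ≠ j, w y ≠ 0)
    {s : ZMod m} {d : ℕ} {w : ZMod m → ZMod 2}
    (hw : Spans W s d w) (hd : d ≤ 3) : d = 1 ∨ d = 2 := by
  have h0 : d ≠ 0 := by
    rintro rfl
    obtain ⟨y, hys, hy⟩ := h1 s w hw.1 hw.2.1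
    obtain ⟨k, hk, rfl⟩ := hw.2.2.2 y hy
    obtain rfl : k = 0 := by omega
    simp at hys
  have h3 : d ≠ 3 := by
    rintro rfl
    refine not_decodes_consecutive hm hC hS (a := s - 1) (b := s) (by ring)
      (hw.decodes_right hm hd (by push_cast; ring))
      ((decodes_succ_iff hC hS s).2 (hw.decodes_left hm hd))
  omega

theorem Spans.eq_of_eq
    (h1 : ∀ j, ∀ w ∈ W, w j ≠ 0 → ∃ y ≠ j, w y ≠ 0)
    {s : ZMod m} {d : ℕ} {v w : ZMod m → ZMod 2}
    (hv : Spans W s d v) (hw : Spans W s d w) (hd : d = 1 ∨ d = 2) : v = w := by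
  by_contra hne
  have hs : v s - w s = 0 := by rw [zmod_two_eq_one hv.2.1, zmod_two_eq_one hw.2.1, sub_self]
  have he : v (s + d) - w (s + d) = 0 := by
    rw [zmod_two_eq_one hv.2.2.1, zmod_two_eq_one hw.2.2.1, sub_self]
  have honly : ∀ y, (v - w) y ≠ 0 → y = s + 1 := by
    intro y hy
    have : v y ≠ 0 ∨ w y ≠ 0 := by
      by_contra! h
      simp [h.1, h.2] at hy
    obtain ⟨k, hk, rfl⟩ := this.elim (hv.2.2.2 y) (hw.2.2.2 y)
    have hk0 : k ≠ 0 := by rintro rfl; simp [hs] at hy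
    have hkd : k ≠ d := by rintro rfl; exact hy he
    obtain rfl : k = 1 := by omega
    simp
  obtain ⟨y, hy⟩ := Function.ne_iff.1 (sub_ne_zero.2 hne)
  obtain ⟨z, hzy, hz⟩ := h1 y _ (W.sub_mem hv.1 hw.1) hy
  exact hzy ((honly z hz).trans (honly y hy).symm)

theorem Spans.eq_of_start_eq (hm : 9 ≤ m) (hC : ∀ a, ∃ j, Decodes W a j)
    (hS : ∀ a j k, Decodes W a j → Decodes W a k → j = k)
    (h1 : ∀ j, ∀ w ∈ W, w j ≠ 0 → ∃ y ≠ j, w y ≠ 0)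
    {s t : ZMod m} {d e : ℕ} {v w : ZMod m → ZMod 2}
    (hv : Spans W s d v) (hw : Spans W t e w) (hd : d = 1 ∨ d = 2) (he : e = 1 ∨ e = 2)
    (hst : s = t) : v = w := by
  subst hst
  have hdv := hv.decodes_right hm (b := s + d - 4) (by omega) (by ring)
  have hdw := hw.decodes_right hm (b := s + e - 4) (by omega) (by ring)
  rcases hd with rfl | rfl <;> rcases he with rfl | rfl
  · exact hv.eq_of_eq h1 hw (by omega)
  · exact (not_decodes_consecutive hm hC hS (by push_cast; ring) hdv hdw).elim
  · exact (not_decodes_consecutive hm hC hS (by push_cast; ring) hdw hdv).elim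
  · exact hv.eq_of_eq h1 hw (by omega)

theorem Spans.eq_of_end_eq (hm : 9 ≤ m) (hC : ∀ a, ∃ j, Decodes W a j)
    (hS : ∀ a j k, Decodes W a j → Decodes W a k → j = k)
    (h1 : ∀ j, ∀ w ∈ W, w j ≠ 0 → ∃ y ≠ j, w y ≠ 0)
    {s t : ZMod m} {d e : ℕ} {v w : ZMod m → ZMod 2}
    (hv : Spans W s d v) (hw : Spans W t e w) (hd : d = 1 ∨ d = 2) (he : e = 1 ∨ e = 2)
    (hst : s + d = t + e) : v = w := by
  have hdv := (decodes_succ_iff hC hS s).2 (hv.decodes_left hm (by omega))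
  have hdw := (decodes_succ_iff hC hS t).2 (hw.decodes_left hm (by omega))
  rcases hd with rfl | rfl <;> rcases he with rfl | rfl
  · obtain rfl : s = t := by simpa using hst
    exact hv.eq_of_eq h1 hw (by omega)
  · refine (not_decodes_consecutive hm hC hS ?_ hdw hdv).elim
    push_cast at hst
    linear_combination hst
  · refine (not_decodes_consecutive hm hC hS ?_ hdv hdw).elim
    push_cast at hst
    linear_combination -hst
  · obtain rfl : s = t := by simpa using hst
    exact hv.eq_of_eq h1 hw (by omega)

/-- Some codeword has support exactly `{x, y}`. -/
def Linked (W : Submodule (ZMod 2) (ZMod m → ZMod 2)) (x y : ZMod m) : Prop :=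
  ∃ w ∈ W, w x ≠ 0 ∧ w y ≠ 0 ∧ ∀ z, w z ≠ 0 → z = x ∨ z = y

theorem Linked.symm {x y : ZMod m} (h : Linked W x y) : Linked W y x := by
  obtain ⟨w, hw, hx, hy, h0⟩ := h
  exact ⟨w, hw, hy, hx, fun z hz => (h0 z hz).symm⟩

theorem Linked.decodes {a x y : ZMod m} (h : Linked W x y) (hx : x ∈ arc a) (hy : y ∉ arc a) :
    Decodes W a y := by
  obtain ⟨w, hw, hwx, hwy, h0⟩ := h
  refine ⟨hy, w, hw, hwy, fun z hz hzy => ?_⟩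
  by_contra hne
  rcases h0 z hne with rfl | rfl
  · exact hz hx
  · exact hzy rfl

/-- Restriction of vectors to the complement of `arc a`, as a linear map. -/
noncomputable def truncate (a : ZMod m) : (ZMod m → ZMod 2) →ₗ[ZMod 2] (ZMod m → ZMod 2) where
  toFun f := (arc a)ᶜ.indicator f
  map_add' f g := Set.indicator_add _ f g
  map_smul' c f := Set.indicator_const_smul _ c f

theorem truncate_of_mem {a y : ZMod m} (f : ZMod m → ZMod 2) (h : y ∈ arc a) :
    truncate a f y = 0 :=
  Set.indicator_of_notMem (by simpa using h) f

theorem truncate_of_notMem {a y : ZMod m} (f : ZMod m → ZMod 2) (h : y ∉ arc a) :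
    truncate a f y = f y :=
  Set.indicator_of_mem (by simpa using h) f

theorem Spans.truncate_ends (hm : 9 ≤ m) (hC : ∀ a, ∃ j, Decodes W a j)
    (hS : ∀ a j k, Decodes W a j → Decodes W a k → j = k)
    {a s : ZMod m} {d : ℕ} {w : ZMod m → ZMod 2}
    (hw : Spans W s d w) (hd : d = 1 ∨ d = 2)
    (hR : ¬ Decodes W a (a + 4)) (hL : ¬ Decodes W (a - 1) (a - 1 + 4))
    (hQ : ¬ Linked W (a + 3) (a + 5)) (hQ' : ¬ Linked W (a - 2) a) :
    truncate a w = 0 ∨ ∃ i j : ℕ, 4 ≤ i ∧ i < j ∧ j < m ∧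
      truncate a w (a + i) ≠ 0 ∧ truncate a w (a + j) ≠ 0 ∧
      (∀ n : ℕ, n < m → truncate a w (a + n) ≠ 0 → i ≤ n ∧ n ≤ j) ∧
      (s = a + i ∨ s = a + 3 ∧ i = 4) ∧ (s + d = a + j ∨ s + d = a ∧ j = m - 1) := by
  have : NeZero m := ⟨by omega⟩
  obtain ⟨k, hk, rfl⟩ : ∃ k : ℕ, k < m ∧ s = a + k :=
    ⟨(s - a).val, ZMod.val_lt _, by simp⟩
  have hin : ∀ n : ℕ, n < 4 → truncate a w (a + n) = 0 := fun n hn =>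
    truncate_of_mem w ⟨n, hn, rfl⟩
  have hout : ∀ n : ℕ, 4 ≤ n → n < m → truncate a w (a + n) = w (a + n) := fun n h4 hn =>
    truncate_of_notMem w (notMem_arc n h4 hn rfl)
  have hsupp : ∀ n : ℕ, n < m → w (a + n) ≠ 0 → ∃ l ≤ d, n = k + l ∨ n + m = k + l := by
    intro n hn hne
    obtain ⟨l, hl, h⟩ := hw.2.2.2 _ hne
    refine ⟨l, hl, ?_⟩
    have h' : (n : ZMod m) = ((k + l : ℕ) : ZMod m) := by
      push_cast
      linear_combination h
    by_cases hkl : k + l < m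
    · exact Or.inl (natCast_inj_of_lt hn hkl h')
    · refine Or.inr ?_
      have := natCast_inj_of_lt (k := k + l - m) hn (by omega) (by
        rw [h', Nat.cast_sub (by omega)]
        simp)
      omega
  have hsuppT : ∀ n : ℕ, n < m → truncate a w (a + n) ≠ 0 →
      4 ≤ n ∧ ∃ l ≤ d, n = k + l ∨ n + m = k + l := by
    intro n hn hne
    have h4 : 4 ≤ n := by
      by_contra h
      exact hne (hin n (by omega))
    exact ⟨h4, hsupp n hn (by rwa [hout n h4 hn] at hne)⟩
  have hstart := (decodes_succ_iff hC hS _).2 (hw.decodes_left hm (by omega))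
  have hend : ∀ b, a + k + (d : ZMod m) = b + 4 → Decodes W b (b + 4) :=
    fun b hb => hw.decodes_right hm (by omega) hb
  have hm1 : ((m - 1 : ℕ) : ZMod m) = -1 := by
    rw [Nat.cast_sub (by omega)]
    simp
  have hm2 : ((m - 2 : ℕ) : ZMod m) = -2 := by
    rw [Nat.cast_sub (by omega)]
    simp
  have hk0 : k ≠ 0 := by
    rintro rfl
    exact hR (by simpa using hstart)
  have hkm : k ≠ m - 1 := by
    rintro rfl
    rw [hm1, ← sub_eq_add_neg] at hstart
    exact hL hstart
  have hcast : (k : ZMod m) + d = ((k + d : ℕ) : ZMod m) := by push_cast; ring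
  have hk4 : k + d ≠ 4 := by
    intro h
    refine hR (hend a ?_)
    rw [add_assoc, hcast, h]
    push_cast
    ring
  have hk3 : k + d ≠ 3 := by
    intro h
    refine hL (hend (a - 1) ?_)
    rw [add_assoc, hcast, h]
    push_cast
    ring
  by_cases hk1 : k = 1
  · left
    ext y
    obtain ⟨n, hn, rfl⟩ : ∃ n : ℕ, n < m ∧ y = a + n := ⟨(y - a).val, ZMod.val_lt _, by simp⟩
    by_contra hne
    obtain ⟨h4, l, hl, h⟩ := hsuppT n hn hne
    omega
  right
  have hws := hw.2.1
  have hwe := hw.2.2.1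
  by_cases hk3' : k = 3
  · obtain rfl : d = 2 := by omega
    subst hk3'
    have h5 : w (a + (5 : ℕ)) ≠ 0 := by
      convert hwe using 2
      push_cast
      ring
    refine ⟨4, 5, by omega, by omega, by omega, ?_, ?_, ?_, ?_, ?_⟩
    · rw [hout 4 (by omega) (by omega)]
      intro h4
      refine hQ ⟨w, hw.1, by simpa using hws, by simpa using h5, fun z hz => ?_⟩
      obtain ⟨l, hl, rfl⟩ := hw.2.2.2 z hz
      have hl1 : l ≠ 1 := by
        rintro rfl
        refine hz ?_
        convert h4 using 2
        push_cast
        ring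
      obtain rfl | rfl : l = 0 ∨ l = 2 := by omega
      · left
        push_cast
        ring
      · right
        push_cast
        ring
    · rwa [hout 5 (by omega) (by omega)]
    · intro n hn hne
      obtain ⟨h4, l, hl, h⟩ := hsuppT n hn hne
      omega
    · right
      simp
    · left
      push_cast
      ring
  by_cases hkd : k + d = m
  · obtain rfl : d = 2 := by omega
    obtain rfl : k = m - 2 := by omega
    refine ⟨m - 2, m - 1, by omega, by omega, by omega, ?_, ?_, ?_, Or.inl rfl, Or.inr ?_⟩
    · rwa [hout _ (by omega) (by omega)]
    · rw [hout _ (by omega) (by omega)]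
      intro h1
      refine hQ' ⟨w, hw.1, ?_, ?_, fun z hz => ?_⟩
      · rwa [hm2, ← sub_eq_add_neg] at hws
      · rw [hm2] at hwe
        convert hwe using 2
        push_cast
        ring
      · obtain ⟨l, hl, rfl⟩ := hw.2.2.2 z hz
        have hl1 : l ≠ 1 := by
          rintro rfl
          refine hz ?_
          convert h1 using 2
          rw [hm1, hm2]
          push_cast
          ring
        rw [hm2]
        obtain rfl | rfl : l = 0 ∨ l = 2 := by omega
        · left
          push_cast
          ring
        · right
          push_cast
          ring
    · intro n hn hne
      obtain ⟨h4, l, hl, h⟩ := hsuppT n hn hne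
      omega
    · refine ⟨?_, rfl⟩
      rw [hm2]
      push_cast
      ring
  · refine ⟨k, k + d, by omega, by omega, by omega, ?_, ?_, ?_, Or.inl rfl, Or.inl ?_⟩
    · rwa [hout _ (by omega) (by omega)]
    · rw [hout _ (by omega) (by omega), ← hcast, ← add_assoc]
      exact hwe
    · intro n hn hne
      obtain ⟨h4, l, hl, h⟩ := hsuppT n hn hne
      omega
    · rw [← hcast, add_assoc]

end

theorem decodes_or_linked (hm : 9 ≤ m)
    (hC : ∀ a, ∃ j, Decodes (Submodule.span (ZMod 2) G) a j)
    (hS : ∀ a j k, Decodes (Submodule.span (ZMod 2) G) a j →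
      Decodes (Submodule.span (ZMod 2) G) a k → j = k)
    (hG : ∀ g ∈ G, ∃ p, ∀ y, g y ≠ 0 → y ∈ arc p) (a : ZMod m) :
    Decodes (Submodule.span (ZMod 2) G) a (a + 4) ∨
    Decodes (Submodule.span (ZMod 2) G) (a - 1) (a - 1 + 4) ∨
    Linked (Submodule.span (ZMod 2) G) (a + 3) (a + 5) ∨
    Linked (Submodule.span (ZMod 2) G) (a - 2) a := by
  classical
  have : NeZero m := ⟨by omega⟩
  by_contra! hN
  obtain ⟨hR, hL, hQ, hQ'⟩ := hN
  have h1 : ∀ j, ∀ w ∈ Submodule.span (ZMod 2) G, w j ≠ 0 → ∃ y ≠ j, w y ≠ 0 :=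
    fun j w hw hwj => single_notMem_code hm hC hS hG j hw hwj
  have key : ∀ f : ZMod m → ZMod 2, ∃ i j : ℕ, f ∈ truncate a '' G \ {0} →
      ∃ g s d, Spans (Submodule.span (ZMod 2) G) s d g ∧ (d = 1 ∨ d = 2) ∧ f = truncate a g ∧
        4 ≤ i ∧ i < j ∧ j < m ∧ f (a + i) ≠ 0 ∧ f (a + j) ≠ 0 ∧
        (∀ n : ℕ, n < m → f (a + n) ≠ 0 → i ≤ n ∧ n ≤ j) ∧
        (s = a + i ∨ s = a + 3 ∧ i = 4) ∧ (s + d = a + j ∨ s + d = a ∧ j = m - 1) := by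
    intro f
    by_cases hf : f ∈ truncate a '' G \ {0}
    · obtain ⟨⟨g, hg, rfl⟩, hg0⟩ := hf
      obtain ⟨p, hp⟩ := hG g hg
      have hgne : g ≠ 0 := by
        rintro rfl
        simp at hg0
      obtain ⟨s, d, hd3, hsp⟩ := exists_spans (Submodule.subset_span hg) hp hgne
      have hd := hsp.length hm hC hS h1 hd3
      rcases hsp.truncate_ends hm hC hS hd hR hL hQ hQ' with h0 | ⟨i, j, h⟩
      · exact absurd h0 hg0
      · exact ⟨i, j, fun _ => ⟨g, s, d, hsp, hd, rfl, h⟩⟩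
    · exact ⟨0, 0, fun h => absurd h hf⟩
  choose lo hi key using key
  obtain ⟨x, hxa, w, hw, hwx, hw0⟩ := hC a
  have hval : ∀ n : ℕ, n < m → (a + n - a : ZMod m).val = n := fun n hn => by
    rw [add_sub_cancel_left, ZMod.val_natCast_of_lt hn]
  refine single_notMem_span_of_distinct_ends (K := ZMod 2) (fun y => (y - a).val)
    (truncate a '' G \ {0}) (fun f => a + lo f) (fun f => a + hi f) ?_ ?_ ?_ ?_ ?_ ?_ x ?_
  · intro f hf
    obtain ⟨g, s, d, -, -, -, -, -, -, h, -⟩ := key f hf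
    exact h
  · intro f hf
    obtain ⟨g, s, d, -, -, -, -, -, -, -, h, -⟩ := key f hf
    exact h
  · intro f hf
    obtain ⟨g, s, d, -, -, -, -, hij, hj, -⟩ := key f hf
    simp only [hval _ (hij.trans hj), hval _ hj]
    exact hij
  · intro f hf y hy
    obtain ⟨g, s, d, -, -, -, -, hij, hj, -, -, h, -⟩ := key f hf
    simp only [hval _ (hij.trans hj), hval _ hj]
    exact h _ (ZMod.val_lt _) (by simpa using hy)
  · intro f hf f' hf' hff
    obtain ⟨g, s, d, hsp, hd, hfg, -, hij, hj, -, -, -, hs, -⟩ := key f hf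
    obtain ⟨g', s', d', hsp', hd', hfg', -, hij', hj', -, -, -, hs', -⟩ := key f' hf'
    simp only [hval _ (hij.trans hj), hval _ (hij'.trans hj')] at hff
    rw [hfg, hfg']
    congr 1
    have hr := (decodes_succ_iff hC hS _).2 (hsp.decodes_left hm (by omega))
    have hr' := (decodes_succ_iff hC hS _).2 (hsp'.decodes_left hm (by omega))
    rcases hs with hs | ⟨hs, hi4⟩ <;> rcases hs' with hs' | ⟨hs', hi4'⟩
    · exact hsp.eq_of_start_eq hm hC hS h1 hsp' hd hd' (by rw [hs, hs', hff])
    · refine (not_decodes_consecutive hm hC hS ?_ hr' hr).elim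
      rw [hs, hs', hff, hi4']
      push_cast
      ring
    · refine (not_decodes_consecutive hm hC hS ?_ hr hr').elim
      rw [hs, hs', ← hff, hi4]
      push_cast
      ring
    · exact hsp.eq_of_start_eq hm hC hS h1 hsp' hd hd' (by rw [hs, hs'])
  · intro f hf f' hf' hff
    obtain ⟨g, s, d, hsp, hd, hfg, -, hij, hj, -, -, -, -, hs⟩ := key f hf
    obtain ⟨g', s', d', hsp', hd', hfg', -, hij', hj', -, -, -, -, hs'⟩ := key f' hf'
    simp only [hval _ hj, hval _ hj'] at hff
    rw [hfg, hfg']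
    congr 1
    have hr := hsp.decodes_right hm (by omega) (b := s + d - 4) (by ring)
    have hr' := hsp'.decodes_right hm (by omega) (b := s' + d' - 4) (by ring)
    have hm1 : ((m - 1 : ℕ) : ZMod m) = -1 := by
      rw [Nat.cast_sub (by omega)]
      simp
    rcases hs with hs | ⟨hs, hi4⟩ <;> rcases hs' with hs' | ⟨hs', hi4'⟩
    · exact hsp.eq_of_end_eq hm hC hS h1 hsp' hd hd' (by rw [hs, hs', hff])
    · refine (not_decodes_consecutive hm hC hS ?_ hr hr').elim
      rw [hs, hs', hff, hi4', hm1]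
      ring
    · refine (not_decodes_consecutive hm hC hS ?_ hr' hr).elim
      rw [hs, hs', ← hff, hi4, hm1]
      ring
    · exact hsp.eq_of_end_eq hm hC hS h1 hsp' hd hd' (by rw [hs, hs'])
  · rw [Submodule.span_sdiff_singleton_zero, Submodule.span_image]
    refine ⟨w, hw, ?_⟩
    ext y
    by_cases hyx : y = x
    · subst hyx
      rw [truncate_of_notMem w hxa, Pi.single_eq_same, zmod_two_eq_one hwx]
    · rw [Pi.single_eq_of_ne hyx]
      by_cases hya : y ∈ arc a
      · exact truncate_of_mem w hya
      · rw [truncate_of_notMem w hya, hw0 y hya hyx]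

theorem even_of_decodes_or_linked (hm : 9 ≤ m) {W : Submodule (ZMod 2) (ZMod m → ZMod 2)}
    (hC : ∀ a, ∃ j, Decodes W a j)
    (hS : ∀ a j k, Decodes W a j → Decodes W a k → j = k)
    (h : ∀ a, Decodes W a (a + 4) ∨ Decodes W (a - 1) (a - 1 + 4) ∨
      Linked W (a + 3) (a + 5) ∨ Linked W (a - 2) a) : Even m := by
  have : NeZero m := ⟨by omega⟩
  let P : ZMod m → ZMod m → Prop := fun a b =>
    (Decodes W a (a + 4) ∧ b = a + 1) ∨ (Decodes W b (b + 4) ∧ a = b + 1) ∨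
    (Linked W (a + 3) (a + 5) ∧ b = a + 5) ∨ (Linked W (b + 3) (b + 5) ∧ a = b + 5)
  have hsymm : ∀ a b, P a b → P b a := by
    rintro a b (h | h | h | h)
    exacts [Or.inr (Or.inl h), Or.inl h, Or.inr (Or.inr (Or.inr h)), Or.inr (Or.inr (Or.inl h))]
  have hex : ∀ a, ∃ b, P a b := by
    intro a
    rcases h a with h | h | h | h
    · exact ⟨a + 1, Or.inl ⟨h, rfl⟩⟩
    · exact ⟨a - 1, Or.inr (Or.inl ⟨h, by ring⟩)⟩
    · exact ⟨a + 5, Or.inr (Or.inr (Or.inl ⟨h, rfl⟩))⟩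
    · refine ⟨a - 5, Or.inr (Or.inr (Or.inr ⟨?_, by ring⟩))⟩
      convert h using 1 <;> ring
  have hdec : ∀ a b, P a b → (Decodes W a (a + 4) ∧ b = a + 1) ∨
      (Decodes W a (a - 1) ∧ b = a - 1) ∨ (Decodes W a (a + 5) ∧ b = a + 5) ∨
      (Decodes W a (a - 2) ∧ b = a - 5) := by
    rintro a b (h | ⟨h, rfl⟩ | ⟨h, rfl⟩ | ⟨h, rfl⟩)
    · exact Or.inl h
    · refine Or.inr (Or.inl ?_)
      rw [add_sub_cancel_right]
      exact ⟨(decodes_succ_iff hC hS b).1 h, rfl⟩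
    · refine Or.inr (Or.inr (Or.inl ⟨h.decodes ⟨3, by omega, by simp⟩ ?_, rfl⟩))
      exact notMem_arc 5 (by omega) (by omega) (by simp)
    · refine Or.inr (Or.inr (Or.inr ⟨?_, by ring⟩))
      rw [show b + 5 - 2 = b + 3 by ring]
      refine h.symm.decodes ⟨0, by omega, by simp⟩ (notMem_arc (m - 2) (by omega) (by omega) ?_)
      rw [Nat.cast_sub (by omega)]
      push_cast
      rw [ZMod.natCast_self]
      ring
  have hne : ∀ n : ℕ, 0 < n → n < 9 → (n : ZMod m) ≠ 0 := fun n h0 hn =>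
    natCast_ne_zero_of_lt h0 (by omega)
  have h1 := hne 1 (by omega) (by omega)
  have h5 := hne 5 (by omega) (by omega)
  have h6 := hne 6 (by omega) (by omega)
  have h7 := hne 7 (by omega) (by omega)
  push_cast at h1 h5 h6 h7
  have huniq : ∀ a b c, P a b → P a c → b = c := by
    intro a b c hb hc
    rcases hdec a b hb with ⟨hb', rfl⟩ | ⟨hb', rfl⟩ | ⟨hb', rfl⟩ | ⟨hb', rfl⟩ <;>
    rcases hdec a c hc with ⟨hc', rfl⟩ | ⟨hc', rfl⟩ | ⟨hc', rfl⟩ | ⟨hc', rfl⟩ <;>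
    first
    | rfl
    | (exfalso
       have := hS _ _ _ hb' hc'
       first
       | exact h1 (by linear_combination this)
       | exact h1 (by linear_combination -this)
       | exact h5 (by linear_combination this)
       | exact h5 (by linear_combination -this)
       | exact h6 (by linear_combination this)
       | exact h6 (by linear_combination -this)
       | exact h7 (by linear_combination this)
       | exact h7 (by linear_combination -this))
  have hirr : ∀ a b, P a b → b ≠ a := by
    rintro a b (⟨-, h⟩ | ⟨-, h⟩ | ⟨-, h⟩ | ⟨-, h⟩) rfl
    · exact h1 (by linear_combination -h)
    · exact h1 (by linear_combination -h)
    · exact h5 (by linear_combination -h)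
    · exact h5 (by linear_combination -h)
  choose f hf using hex
  have hsum : ∑ _a : ZMod m, (1 : ZMod 2) = 0 :=
    Finset.sum_involution (fun a _ => f a) (fun _ _ => by decide) (fun a _ _ => hirr _ _ (hf a))
      (fun _ _ => Finset.mem_univ _) (fun a _ => huniq _ _ _ (hf (f a)) (hsymm _ _ (hf a)))
  rw [Finset.sum_const, Finset.card_univ, ZMod.card, nsmul_eq_mul, mul_one] at hsum
  exact even_iff_two_dvd.2 ((ZMod.natCast_eq_zero_iff m 2).1 hsum)

theorem sideInfo_four (i : ZMod m) : sideInfo m 4 i = arc (i - 3) := by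
  have hsub : ∀ k : ℕ, k < 4 → ((3 - k : ℕ) : ZMod m) = 3 - k := fun k hk => by
    rw [Nat.cast_sub (by omega)]
    simp
  ext y
  constructor
  · rintro ⟨k, hk, rfl⟩
    have hk' := Finset.mem_range.1 hk
    refine ⟨3 - k, by omega, ?_⟩
    rw [hsub k hk']
    ring
  · rintro ⟨k, hk, rfl⟩
    refine ⟨3 - k, Finset.mem_range.2 (by omega), ?_⟩
    rw [hsub k hk]
    ring

theorem mem_decSet_iff [NeZero m] {ℓ : ℕ} (G : Fin ℓ → ZMod m → ZMod 2) (i j : ZMod m) :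
    j ∈ decSet m 4 G i ↔ Decodes (Submodule.span (ZMod 2) (Set.range G)) (i - 3) j := by
  classical
  rw [decSet, Set.mem_ofPred_eq, sideInfo_four, Decodes, Submodule.span_union]
  refine and_congr_right fun hj => ⟨fun h => ?_, ?_⟩
  · obtain ⟨w, hw, v, hv, hwv⟩ := Submodule.mem_sup.1 h
    have hv0 : ∀ y ∉ arc (i - 3), v y = 0 := by
      intro y hy
      by_contra hne
      obtain ⟨g, ⟨k, hk, rfl⟩, hg⟩ := exists_ne_zero_of_mem_span hv hne
      refine hg (Pi.single_eq_of_ne ?_ _)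
      rintro rfl
      exact hy hk
    have hw0 : ∀ y ∉ arc (i - 3), w y = (Pi.single j 1 : ZMod m → ZMod 2) y := by
      intro y hy
      rw [← hwv, Pi.add_apply, hv0 y hy, add_zero]
    refine ⟨w, hw, ?_, fun y hy hyj => ?_⟩
    · rw [hw0 j hj, Pi.single_eq_same]
      exact one_ne_zero
    · rw [hw0 y hy, Pi.single_eq_of_ne hyj]
  · rintro ⟨w, hw, hwj, hw0⟩
    refine Submodule.mem_sup.2 ⟨w, hw, Pi.single j 1 - w, ?_, by simp⟩
    rw [← Finset.univ_sum_single (Pi.single j 1 - w)]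
    refine Submodule.sum_mem _ fun y _ => ?_
    by_cases hy : y ∈ arc (i - 3)
    · have := Submodule.smul_mem (Submodule.span (ZMod 2)
        {v | ∃ k ∈ arc (i - 3), v = (Pi.single k 1 : ZMod m → ZMod 2)})
        ((Pi.single j 1 - w : ZMod m → ZMod 2) y) (Submodule.subset_span ⟨y, hy, rfl⟩)
      rwa [← Pi.single_smul, smul_eq_mul, mul_one] at this
    · have h0 : (Pi.single j 1 - w : ZMod m → ZMod 2) y = 0 := by
        by_cases hyj : y = j
        · subst hyj
          simp [zmod_two_eq_one hwj]
        · simp [hyj, hw0 y hy hyj]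
      rw [h0, Pi.single_zero]
      exact Submodule.zero_mem _

end SDPicod

theorem infeasible_s_eq_four_odd (m : ℕ) (hm : 9 ≤ m) (hodd : Odd m)
    (ℓ : ℕ) (G : Fin ℓ → ZMod m → ZMod 2)
    (hG : IsDecentralizedCode m 4 G) :
    ¬ (Correct m 4 G ∧ Secure m 4 G) := by
  rintro ⟨hcorrect, hsecure⟩
  have : NeZero m := ⟨by omega⟩
  have hmem : ∀ a j, j ∈ decSet m 4 G (a + 3) ↔
      Decodes (Submodule.span (ZMod 2) (Set.range G)) a j := by
    intro a j
    rw [mem_decSet_iff, add_sub_cancel_right]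
  have hC : ∀ a, ∃ j, Decodes (Submodule.span (ZMod 2) (Set.range G)) a j := by
    intro a
    obtain ⟨j, hj⟩ := hcorrect (a + 3)
    exact ⟨j, (hmem a j).1 hj⟩
  have hS : ∀ a j k, Decodes (Submodule.span (ZMod 2) (Set.range G)) a j →
      Decodes (Submodule.span (ZMod 2) (Set.range G)) a k → j = k :=
    fun a j k hj hk => hsecure (a + 3) ((hmem a j).2 hj) ((hmem a k).2 hk)
  refine Nat.not_even_iff_odd.2 hodd (even_of_decodes_or_linked hm hC hS
    (decodes_or_linked hm hC hS ?_))
  rintro _ ⟨t, rfl⟩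
  obtain ⟨i, hi⟩ := hG t
  rw [sideInfo_four] at hi
  exact ⟨i - 3, fun y hy => hi hy⟩
end

section
/- For all integers m, s with s ≥ 5, m > 2s and m ≡ 2 (mod 2s), there exists a decentralized linear code of length ℓ = 3·(m − 2)/(2·s) + 1 for parameters (m, s) that is both correct and secure. -/
open SDPicod

namespace SDPicod

section Criterion

variable {m s ℓ : ℕ} {S : Fin ℓ → Set (ZMod m)}

open Classical in
/-- The code whose rows are the indicator vectors of the sets `S t`. -/
noncomputable def indicatorCode (S : Fin ℓ → Set (ZMod m)) : Fin ℓ → ZMod m → ZMod 2 :=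
  fun t j => if j ∈ S t then 1 else 0

theorem exists_of_mem_decSet (hS : ∀ t t' x, x ∈ S t → x ∈ S t' → t = t')
    {i x : ZMod m} (hx : x ∈ decSet m s (indicatorCode S) i) :
    ∃ t, x ∈ S t ∧ ∀ y ∈ S t, y ∉ sideInfo m s i → y = x := by
  classical
  obtain ⟨hxA, hspan⟩ := hx
  by_contra! hcon
  obtain ⟨φ, hφG, hφA, hφx⟩ : ∃ φ : (ZMod m → ZMod 2) →ₗ[ZMod 2] ZMod 2,
      (∀ t, φ (indicatorCode S t) = 0) ∧
      (∀ k ∈ sideInfo m s i, φ (Pi.single k 1) = 0) ∧ φ (Pi.single x 1) ≠ 0 := by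
    let coord (j : ZMod m) : (ZMod m → ZMod 2) →ₗ[ZMod 2] ZMod 2 := LinearMap.proj j
    by_cases h : ∃ t, x ∈ S t
    · obtain ⟨t, ht⟩ := h
      obtain ⟨y, hy, hyA, hyx⟩ := hcon t ht
      refine ⟨coord x + coord y, fun t' => ?_, fun k hk => ?_, ?_⟩
      · by_cases htt : t' = t
        · subst htt
          simp only [coord, LinearMap.add_apply, LinearMap.proj_apply, indicatorCode, ht, hy,
            if_true]
          decide
        · have h1 : x ∉ S t' := fun h => htt (hS _ _ _ h ht)
          have h2 : y ∉ S t' := fun h => htt (hS _ _ _ h hy)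
          simp [coord, indicatorCode, h1, h2]
      · have h1 : x ≠ k := fun h => hxA (h ▸ hk)
        have h2 : y ≠ k := fun h => hyA (h ▸ hk)
        simp [coord, h1, h2]
      · simp [coord, hyx]
    · push Not at h
      refine ⟨coord x, fun t' => ?_, fun k hk => ?_, ?_⟩
      · simp [coord, indicatorCode, h]
      · have h1 : x ≠ k := fun h => hxA (h ▸ hk)
        simp [coord, h1]
      · simp [coord]
  have hle : Submodule.span (ZMod 2)
      (Set.range (indicatorCode S) ∪
        {v | ∃ k ∈ sideInfo m s i, v = Pi.single k (1 : ZMod 2)}) ≤ LinearMap.ker φ := by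
    rw [Submodule.span_le]
    rintro v (⟨t, rfl⟩ | ⟨k, hk, rfl⟩)
    · exact hφG t
    · exact hφA k hk
  exact hφx (hle hspan)

theorem mem_decSet_of_unique [NeZero m] {i x : ZMod m} {t : Fin ℓ} (hx : x ∈ S t)
    (hxA : x ∉ sideInfo m s i) (huniq : ∀ y ∈ S t, y ≠ x → y ∈ sideInfo m s i) :
    x ∈ decSet m s (indicatorCode S) i := by
  classical
  refine ⟨hxA, ?_⟩
  have key : (Pi.single x (1 : ZMod 2) : ZMod m → ZMod 2) = indicatorCode S t -
      ∑ y ∈ Finset.univ.filter (fun y => y ∈ S t ∧ y ≠ x), Pi.single y (1 : ZMod 2) := by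
    funext z
    simp only [Pi.sub_apply, Finset.sum_apply, Pi.single_apply, indicatorCode,
      Finset.sum_ite_eq, Finset.mem_filter, Finset.mem_univ, true_and]
    by_cases hz : z = x
    · subst hz; simp [hx]
    · by_cases hzS : z ∈ S t <;> simp [hz, hzS]
  rw [key]
  refine Submodule.sub_mem _ (Submodule.subset_span (Or.inl ⟨t, rfl⟩))
    (Submodule.sum_mem _ fun y hy => Submodule.subset_span (Or.inr ⟨y, ?_, rfl⟩))
  simp only [Finset.mem_filter, Finset.mem_univ, true_and] at hy
  exact huniq y hy.1 hy.2

end Criterion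

/-- The window of `s` cyclically consecutive residues ending at `i`, on representatives. -/
def InWindow (m s i j : ℕ) : Prop := (j ≤ i ∧ i < j + s) ∨ i + m < j + s

theorem mem_sideInfo_iff {m s : ℕ} [NeZero m] (hs : s ≤ m) (i j : ZMod m) :
    j ∈ sideInfo m s i ↔ InWindow m s i.val j.val := by
  have hi := i.val_lt
  have hj := j.val_lt
  constructor
  · rintro ⟨k, hk, rfl⟩
    rw [Finset.mem_range] at hk
    have hkv : (k : ZMod m).val = k := ZMod.val_natCast_of_lt (by omega)
    have hsum : (i - (k : ZMod m) + k).val = i.val := by rw [sub_add_cancel]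
    rw [ZMod.val_add, hkv] at hsum
    unfold InWindow
    rcases lt_or_ge ((i - (k : ZMod m)).val + k) m with h | h
    · rw [Nat.mod_eq_of_lt h] at hsum
      omega
    · rw [Nat.mod_eq_sub_mod h, Nat.mod_eq_of_lt (by omega)] at hsum
      omega
  · rintro (⟨h1, h2⟩ | h)
    · refine ⟨i.val - j.val, Finset.mem_range.2 (by omega), ?_⟩
      rw [Nat.cast_sub h1]
      simp
    · refine ⟨i.val + m - j.val, Finset.mem_range.2 (by omega), ?_⟩
      rw [Nat.cast_sub (by omega)]
      simp

/-- Membership of `x` in the support of the row of kind `r` attached to the block starting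
at `b`, for the code of length `M + 2`, where `M` is a multiple of the block size `2 * s`. -/
def RowSupport (s M b r x : ℕ) : Prop :=
  (r = 0 ∧ (x = b ∨ (b < M ∧ x + 2 = b + s) ∨ (b = M ∧ x = b + 1))) ∨
  (r = 1 ∧ (x + 1 = b + s ∨ x = b + s)) ∨
  (r = 2 ∧ (x + 2 = b + 2 * s ∨ x + 1 = b + 2 * s ∨
    (b + 2 * s = M ∧ (x = b + s + 1 ∨ x = b + s + 2))))

/-- The users `i` served by the row of kind `r` attached to the block starting at `b`. -/
def Serves (s M b r i : ℕ) : Prop :=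
  (r = 0 ∧ ((b < M ∧ ((b ≤ i ∧ i + 2 < b + s) ∨ (b + s ≤ i ∧ i + 2 < b + 2 * s))) ∨
    (b = M ∧ (i = M ∨ i + 2 = s)))) ∨
  (r = 1 ∧ (i + 1 = b + s ∨ i + 1 = b + 2 * s)) ∨
  (r = 2 ∧ (i + 2 = b + 2 * s ∨ (b + 2 * s < M ∧ i + 2 = b + 3 * s) ∨
    (b + 2 * s = M ∧ i = M + 1)))

/-- The admissible pairs of a block start and a row kind. -/
def IsRow (s M b r : ℕ) : Prop :=
  (r < 3 ∧ b + 2 * s ≤ M) ∨ (r = 0 ∧ b = M)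

/-- Two block starts coincide, are one block apart, or are at least two blocks apart. -/
def BlockApart (s b b' : ℕ) : Prop :=
  b = b' ∨ b + 2 * s = b' ∨ b' + 2 * s = b ∨ b + 4 * s ≤ b' ∨ b' + 4 * s ≤ b

section Rows

variable {s M b r : ℕ}

theorem RowSupport.lt (hs : 5 ≤ s) (h : IsRow s M b r) {x : ℕ} (hx : RowSupport s M b r x) :
    x < M + 2 := by
  unfold IsRow RowSupport at *
  omega

theorem RowSupport.unique (hs : 5 ≤ s) {b' r' : ℕ} (h : IsRow s M b r) (h' : IsRow s M b' r')
    (hb : BlockApart s b b') {x : ℕ} (hx : RowSupport s M b r x)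
    (hx' : RowSupport s M b' r' x) : b = b' ∧ r = r' := by
  unfold IsRow RowSupport BlockApart at *
  rcases hb with rfl | rfl | rfl | hb | hb <;>
  rcases hx with ⟨rfl, hx⟩ | ⟨rfl, hx⟩ | ⟨rfl, hx⟩ <;>
  rcases hx' with ⟨rfl, hx'⟩ | ⟨rfl, hx'⟩ | ⟨rfl, hx'⟩ <;> omega

theorem Serves.unique (hs : 5 ≤ s) {b' r' : ℕ} (h : IsRow s M b r) (h' : IsRow s M b' r')
    (hb : BlockApart s b b') (hb0 : BlockApart s b 0) (hb0' : BlockApart s b' 0) {i : ℕ}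
    (hi : Serves s M b r i) (hi' : Serves s M b' r' i) : b = b' ∧ r = r' := by
  unfold IsRow Serves BlockApart at *
  rcases hb with rfl | rfl | rfl | hb | hb <;>
  rcases hi with ⟨rfl, hi⟩ | ⟨rfl, hi⟩ | ⟨rfl, hi⟩ <;>
  rcases hi' with ⟨rfl, hi'⟩ | ⟨rfl, hi'⟩ | ⟨rfl, hi'⟩ <;> omega

theorem exists_window (hs : 5 ≤ s) (h : IsRow s M b r) :
    ∃ i < M + 2, ∀ x, RowSupport s M b r x → InWindow (M + 2) s i x := by
  unfold IsRow RowSupport InWindow at *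
  rcases h with ⟨hr, hb⟩ | ⟨rfl, rfl⟩
  · interval_cases r
    · exact ⟨b + s - 2, by omega, fun x hx => by omega⟩
    · exact ⟨b + s, by omega, fun x hx => by omega⟩
    · exact ⟨b + 2 * s - 1, by omega, fun x hx => by omega⟩
  · exact ⟨b + 1, by omega, fun x hx => by omega⟩

theorem Serves.exists_missing (hs : 5 ≤ s) (hM : 2 * s ≤ M) (h : IsRow s M b r) {i : ℕ}
    (hi : Serves s M b r i) :
    ∃ x, RowSupport s M b r x ∧ ¬ InWindow (M + 2) s i x ∧
      ∀ y, RowSupport s M b r y → y ≠ x → InWindow (M + 2) s i y := by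
  unfold IsRow Serves RowSupport InWindow at *
  rcases hi with ⟨rfl, hi⟩ | ⟨rfl, hi⟩ | ⟨rfl, hi⟩
  · rcases hi with ⟨hb, hi | hi⟩ | ⟨rfl, hi | hi⟩
    · exact ⟨b + s - 2, by omega, by omega, fun y hy hne => by omega⟩
    · exact ⟨b, by omega, by omega, fun y hy hne => by omega⟩
    · exact ⟨b + 1, by omega, by omega, fun y hy hne => by omega⟩
    · exact ⟨b, by omega, by omega, fun y hy hne => by omega⟩
  · rcases hi with hi | hi
    · exact ⟨b + s, by omega, by omega, fun y hy hne => by omega⟩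
    · exact ⟨b + s - 1, by omega, by omega, fun y hy hne => by omega⟩
  · rcases hi with hi | hi | hi
    · exact ⟨b + 2 * s - 1, by omega, by omega, fun y hy hne => by omega⟩
    · exact ⟨b + 2 * s - 2, by omega, by omega, fun y hy hne => by omega⟩
    · exact ⟨b + s + 1, by omega, by omega, fun y hy hne => by omega⟩

theorem exists_ne_of_not_serves (hs : 5 ≤ s) (hM : 2 * s ≤ M) (h : IsRow s M b r)
    (hbM : BlockApart s b M) {i x : ℕ} (hiM : i < M + 2) (hx : RowSupport s M b r x)
    (hxi : ¬ InWindow (M + 2) s i x)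
    (hi : ¬ Serves s M b r i) :
    ∃ y, RowSupport s M b r y ∧ y ≠ x ∧ ¬ InWindow (M + 2) s i y := by
  by_contra! hcon
  unfold IsRow Serves RowSupport InWindow BlockApart at *
  rcases h with ⟨hr, hb⟩ | ⟨rfl, rfl⟩
  · interval_cases r
    · have h1 := hcon b
      have h2 := hcon (b + s - 2)
      omega
    · have h1 := hcon (b + s - 1)
      have h2 := hcon (b + s)
      omega
    · have h1 := hcon (b + 2 * s - 2)
      have h2 := hcon (b + 2 * s - 1)
      rcases Nat.eq_or_lt_of_le hb with hb | hb
      · have h3 := hcon (b + s + 1)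
        have h4 := hcon (b + s + 2)
        omega
      · omega
  · have h1 := hcon b
    have h2 := hcon (b + 1)
    omega

end Rows

theorem exists_serves {s q i : ℕ} (hs : 5 ≤ s) (hq : 0 < q) (hi : i < 2 * s * q + 2) :
    ∃ t < 3 * q + 1, Serves s (2 * s * q) (2 * s * (t / 3)) (t % 3) i := by
  unfold Serves
  set M := 2 * s * q with hMdef
  have hblock : ∀ k r, r < 3 → (3 * k + r) / 3 = k ∧ (3 * k + r) % 3 = r := by omega
  rcases Nat.lt_or_ge i M with hiM | hiM
  · obtain ⟨k, ρ, hρ, hik⟩ : ∃ k ρ, ρ < 2 * s ∧ i = 2 * s * k + ρ :=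
      ⟨i / (2 * s), i % (2 * s), Nat.mod_lt _ (by omega), (Nat.div_add_mod _ _).symm⟩
    have hkq : k < q := by
      by_contra! h
      have := Nat.mul_le_mul_left (2 * s) h
      omega
    have hkM : 2 * s * k + 2 * s ≤ M := Nat.mul_le_mul_left (2 * s) (Nat.succ_le_of_lt hkq)
    by_cases h0 : ρ + 2 = s
    · rcases k with _ | k
      · refine ⟨3 * q, by omega, ?_⟩
        rw [show 3 * q / 3 = q by omega, ← hMdef]
        omega
      · refine ⟨3 * k + 2, by omega, ?_⟩
        rw [(hblock k 2 (by omega)).1, (hblock k 2 (by omega)).2]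
        rw [Nat.mul_succ] at hik hkM
        omega
    · obtain ⟨r, hr, h⟩ : ∃ r < 3, (r = 0 ∧ (ρ + 2 < s ∨ s ≤ ρ ∧ ρ + 2 < 2 * s)) ∨
          (r = 1 ∧ (ρ + 1 = s ∨ ρ + 1 = 2 * s)) ∨ (r = 2 ∧ ρ + 2 = 2 * s) := by
        by_cases h1 : ρ + 1 = s ∨ ρ + 1 = 2 * s
        · exact ⟨1, by omega⟩
        by_cases h2 : ρ + 2 = 2 * s
        · exact ⟨2, by omega⟩
        · exact ⟨0, by omega⟩
      refine ⟨3 * k + r, by omega, ?_⟩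
      rw [(hblock k r hr).1, (hblock k r hr).2]
      omega
  · rcases Nat.eq_or_lt_of_le hiM with h | h
    · refine ⟨3 * q, by omega, ?_⟩
      rw [show 3 * q / 3 = q by omega, ← hMdef]
      omega
    · obtain ⟨k, rfl⟩ : ∃ k, q = k + 1 := ⟨q - 1, by omega⟩
      refine ⟨3 * k + 2, by omega, ?_⟩
      rw [(hblock k 2 (by omega)).1, (hblock k 2 (by omega)).2]
      rw [Nat.mul_succ] at hMdef
      omega

theorem isRow_of_lt {s q t : ℕ} (ht : t < 3 * q + 1) :
    IsRow s (2 * s * q) (2 * s * (t / 3)) (t % 3) := by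
  unfold IsRow
  rcases Nat.lt_or_ge (t / 3) q with h | h
  · have := Nat.mul_le_mul_left (2 * s) (Nat.succ_le_of_lt h)
    left
    rw [Nat.mul_succ] at this
    omega
  · have : t / 3 = q := by omega
    rw [this]
    omega

theorem blockApart_mul (s k k' : ℕ) : BlockApart s (2 * s * k) (2 * s * k') := by
  have key : ∀ k k', k < k' →
      2 * s * k + 2 * s = 2 * s * k' ∨ 2 * s * k + 4 * s ≤ 2 * s * k' := by
    intro k k' h
    rcases Nat.eq_or_lt_of_le (Nat.succ_le_of_lt h) with rfl | h
    · exact Or.inl rfl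
    · have := Nat.mul_le_mul_left (2 * s) (Nat.succ_le_of_lt h)
      simp only [Nat.mul_succ] at this
      omega
  unfold BlockApart
  rcases lt_trichotomy k k' with h | rfl | h
  · have := key _ _ h
    omega
  · exact Or.inl rfl
  · have := key _ _ h
    omega

theorem index_eq_of_row_eq {s t t' : ℕ} (hs : 0 < s)
    (h : 2 * s * (t / 3) = 2 * s * (t' / 3) ∧ t % 3 = t' % 3) : t = t' := by
  have := Nat.eq_of_mul_eq_mul_left (by omega) h.1
  omega

theorem exists_code {s q : ℕ} (hs : 5 ≤ s) (hq : 0 < q) :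
    ∃ G : Fin (3 * q + 1) → ZMod (2 * s * q + 2) → ZMod 2,
      IsDecentralizedCode (2 * s * q + 2) s G ∧ Correct (2 * s * q + 2) s G ∧
        Secure (2 * s * q + 2) s G := by
  have hM : 2 * s ≤ 2 * s * q := Nat.le_mul_of_pos_right _ hq
  have hwin := @mem_sideInfo_iff (2 * s * q + 2) s _ (by omega)
  let S : Fin (3 * q + 1) → Set (ZMod (2 * s * q + 2)) :=
    fun t => {x | RowSupport s (2 * s * q) (2 * s * (t / 3)) (t % 3) x.val}
  have hS : ∀ t t' x, x ∈ S t → x ∈ S t' → t = t' := fun t t' x hx hx' =>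
    Fin.ext (index_eq_of_row_eq (by omega)
      (RowSupport.unique hs (isRow_of_lt t.2) (isRow_of_lt t'.2) (blockApart_mul _ _ _) hx hx'))
  have hserves : ∀ {t x i}, x ∈ S t →
      (∀ y ∈ S t, y ∉ sideInfo (2 * s * q + 2) s i → y = x) →
      x ∉ sideInfo (2 * s * q + 2) s i →
      Serves s (2 * s * q) (2 * s * (t / 3)) (t % 3) i.val := by
    intro t x i hx huniq hxA
    by_contra hns
    rw [hwin] at hxA
    obtain ⟨y, hy, hyx, hyA⟩ :=
      exists_ne_of_not_serves hs hM (isRow_of_lt t.2) (blockApart_mul _ _ _) i.val_lt hx hxA hns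
    have hyv : (y : ZMod (2 * s * q + 2)).val = y :=
      ZMod.val_natCast_of_lt (hy.lt hs (isRow_of_lt t.2))
    apply hyx
    rw [← huniq y (by simpa only [S, Set.mem_ofPred_eq, hyv] using hy)
      (by rwa [hwin, hyv]), hyv]
  refine ⟨indicatorCode S, fun t => ?_, fun i => ?_, fun i x hx x' hx' => ?_⟩
  · obtain ⟨i, hi, h⟩ := exists_window hs (isRow_of_lt (s := s) t.2)
    refine ⟨i, fun x hx => ?_⟩
    rw [hwin, ZMod.val_natCast_of_lt hi]
    refine h _ ?_
    by_contra hxS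
    exact hx (if_neg hxS)
  · obtain ⟨t, ht, hserve⟩ := exists_serves hs hq i.val_lt
    obtain ⟨x, hx, hxA, huniq⟩ := hserve.exists_missing hs hM (isRow_of_lt ht)
    have hxv : (x : ZMod (2 * s * q + 2)).val = x :=
      ZMod.val_natCast_of_lt (hx.lt hs (isRow_of_lt ht))
    refine ⟨x, mem_decSet_of_unique (t := ⟨t, ht⟩) ?_ ?_ fun y hy hyx => ?_⟩
    · simpa only [S, Set.mem_ofPred_eq, hxv] using hx
    · rwa [hwin, hxv]
    · rw [hwin]
      refine huniq _ hy fun h => hyx ?_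
      rw [← h, ZMod.natCast_zmod_val]
  · obtain ⟨t, hxt, hu⟩ := exists_of_mem_decSet hS hx
    obtain ⟨t', hxt', hu'⟩ := exists_of_mem_decSet hS hx'
    have htt : t = t' := Fin.ext (index_eq_of_row_eq (by omega)
      (Serves.unique hs (isRow_of_lt t.2) (isRow_of_lt t'.2) (blockApart_mul _ _ _)
        (blockApart_mul _ _ 0) (blockApart_mul _ _ 0)
        (hserves hxt hu hx.1) (hserves hxt' hu' hx'.1)))
    subst htt
    exact hu' x hxt hx.1

end SDPicod

theorem feasible_mod_two (m s : ℕ) (hs : 5 ≤ s) (hm : 2 * s < m)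
    (hmod : m % (2 * s) = 2) :
    ∃ G : Fin (3 * (m - 2) / (2 * s) + 1) → ZMod m → ZMod 2,
      IsDecentralizedCode m s G ∧ Correct m s G ∧ Secure m s G := by
  obtain ⟨q, hq⟩ : ∃ q, m = 2 * s * q + 2 := ⟨m / (2 * s), by
    have := Nat.div_add_mod m (2 * s)
    omega⟩
  subst hq
  have hq : 0 < q := by
    rcases Nat.eq_zero_or_pos q with rfl | h
    · omega
    · exact h
  have hlen : 3 * (2 * s * q + 2 - 2) / (2 * s) = 3 * q := by
    rw [Nat.add_sub_cancel, mul_left_comm, Nat.mul_div_cancel_left _ (by omega)]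
  rw [hlen]
  exact exists_code hs hq
end
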